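/- Initial-layer estimate: let ψ be Hölder continuous with exponent γ in x and Lipschitz in t on ∂Q_T, let f be continuous on the closure of Q_T and bounded, and let u be the continuous viscosity solution of u_t = F(x, ∇u, D²u) + h(x,t)·∇u|∇u|^α + f(x,t) in Q_T with u = ψ on ∂Q_T. Set q = max(2, (α+2)/(α+1))/γ. Then there exists a constant C₂ such that for all (x,t) ∈ Ω × (0,T): |u(x,t) − ψ(x,0)| ≤ C₂ t^{1/(q(α+1)−α)}. -/

import Mathlib

open Set Filter Metric
open scoped RealInnerProductSpace

noncomputable section

/-- Euclidean space `ℝ^N`. -/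
abbrev EucSp (N : ℕ) := EuclideanSpace ℝ (Fin N)

/-- `N × N` real matrices. -/
abbrev MatN (N : ℕ) := Matrix (Fin N) (Fin N) ℝ

variable {N : ℕ}

/-- Spatial Hessian matrix of a function `φ : ℝ^N → ℝ`. -/
noncomputable def hessMat (φ : EucSp N → ℝ) (x : EucSp N) : MatN N := fun i j =>
  iteratedFDeriv ℝ 2 φ x ![EuclideanSpace.single i (1 : ℝ), EuclideanSpace.single j (1 : ℝ)]

/-- Upper semicontinuous envelope `u*`. -/
noncomputable def uscEnv (u : EucSp N → ℝ → ℝ) (x : EucSp N) (t : ℝ) : ℝ :=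
  Filter.limsup (fun p : EucSp N × ℝ => u p.1 p.2) (nhds (x, t))

/-- Lower semicontinuous envelope `u_*`. -/
noncomputable def lscEnv (u : EucSp N → ℝ → ℝ) (x : EucSp N) (t : ℝ) : ℝ :=
  Filter.liminf (fun p : EucSp N × ℝ => u p.1 p.2) (nhds (x, t))

/-- The first order term `h(x,t)·p |p|^α`. -/
noncomputable def gradTerm (h : EucSp N → ℝ → EucSp N) (α : ℝ) (x : EucSp N) (t : ℝ)
    (p : EucSp N) : ℝ :=
  ⟪h x t, p⟫ * ‖p‖ ^ α

/-- Viscosity subsolution of `u_t - F(x,∇u,D²u) - h(x,t)·∇u|∇u|^α ≤ f` in `Ω × (0,T)`,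
in the sense of Definition 1 of the paper. -/
def IsSubSol (Ω : Set (EucSp N)) (T : ℝ) (F : EucSp N → EucSp N → MatN N → ℝ)
    (h : EucSp N → ℝ → EucSp N) (α : ℝ) (f : EucSp N → ℝ → ℝ)
    (u : EucSp N → ℝ → ℝ) : Prop :=
  ∀ x₀ ∈ Ω, ∀ t₀ ∈ Set.Ioo (0 : ℝ) T,
    (∀ φ : EucSp N → ℝ → ℝ,
      ContDiff ℝ 2 (fun p : EucSp N × ℝ => φ p.1 p.2) →
      (∀ᶠ p : EucSp N × ℝ in nhds (x₀, t₀), uscEnv u p.1 p.2 ≤ φ p.1 p.2) →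
      uscEnv u x₀ t₀ = φ x₀ t₀ →
      gradient (fun x => φ x t₀) x₀ ≠ 0 →
      deriv (fun s => φ x₀ s) t₀
          - F x₀ (gradient (fun x => φ x t₀) x₀) (hessMat (fun x => φ x t₀) x₀)
          - gradTerm h α x₀ t₀ (gradient (fun x => φ x t₀) x₀)
        ≤ f x₀ t₀) ∧
    (∀ δ₁ > (0 : ℝ), ∀ φ : ℝ → ℝ, ContDiff ℝ 2 φ → φ t₀ = 0 →
      (∀ t ∈ Set.Ioo (t₀ - δ₁) (t₀ + δ₁), uscEnv u x₀ t - φ t ≤ uscEnv u x₀ t₀) →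
      (∀ᶠ x in nhds x₀,
        sSup ((fun t => uscEnv u x t - φ t) '' Set.Ioo (t₀ - δ₁) (t₀ + δ₁)) =
          sSup ((fun t => uscEnv u x₀ t - φ t) '' Set.Ioo (t₀ - δ₁) (t₀ + δ₁))) →
      deriv φ t₀ ≤ f x₀ t₀)

/-- Viscosity supersolution of `u_t - F(x,∇u,D²u) - h(x,t)·∇u|∇u|^α ≥ f` in `Ω × (0,T)`,
in the sense of Definition 1 of the paper. -/
def IsSuperSol (Ω : Set (EucSp N)) (T : ℝ) (F : EucSp N → EucSp N → MatN N → ℝ)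
    (h : EucSp N → ℝ → EucSp N) (α : ℝ) (f : EucSp N → ℝ → ℝ)
    (u : EucSp N → ℝ → ℝ) : Prop :=
  ∀ x₀ ∈ Ω, ∀ t₀ ∈ Set.Ioo (0 : ℝ) T,
    (∀ φ : EucSp N → ℝ → ℝ,
      ContDiff ℝ 2 (fun p : EucSp N × ℝ => φ p.1 p.2) →
      (∀ᶠ p : EucSp N × ℝ in nhds (x₀, t₀), φ p.1 p.2 ≤ lscEnv u p.1 p.2) →
      lscEnv u x₀ t₀ = φ x₀ t₀ →
      gradient (fun x => φ x t₀) x₀ ≠ 0 →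
      f x₀ t₀ ≤
        deriv (fun s => φ x₀ s) t₀
          - F x₀ (gradient (fun x => φ x t₀) x₀) (hessMat (fun x => φ x t₀) x₀)
          - gradTerm h α x₀ t₀ (gradient (fun x => φ x t₀) x₀)) ∧
    (∀ δ₁ > (0 : ℝ), ∀ φ : ℝ → ℝ, ContDiff ℝ 2 φ → φ t₀ = 0 →
      (∀ t ∈ Set.Ioo (t₀ - δ₁) (t₀ + δ₁), lscEnv u x₀ t₀ ≤ lscEnv u x₀ t - φ t) →
      (∀ᶠ x in nhds x₀,
        sInf ((fun t => lscEnv u x t - φ t) '' Set.Ioo (t₀ - δ₁) (t₀ + δ₁)) =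
          sInf ((fun t => lscEnv u x₀ t - φ t) '' Set.Ioo (t₀ - δ₁) (t₀ + δ₁))) →
      f x₀ t₀ ≤ deriv φ t₀)

/-- Continuity of `F` on `Ω × (ℝ^N∖{0}) × S`. -/
def Fcont (Ω : Set (EucSp N)) (F : EucSp N → EucSp N → MatN N → ℝ) : Prop :=
  ContinuousOn (fun z : EucSp N × EucSp N × MatN N => F z.1 z.2.1 z.2.2)
    (Ω ×ˢ ({p : EucSp N | p ≠ 0} ×ˢ (Set.univ : Set (MatN N))))

/-- Hypothesis (H1): homogeneity. -/
def H1 (Ω : Set (EucSp N)) (F : EucSp N → EucSp N → MatN N → ℝ) (α : ℝ) : Prop :=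
  ∀ x ∈ Ω, ∀ p : EucSp N, p ≠ 0 → ∀ X : MatN N, X.IsSymm →
    ∀ t : ℝ, t ≠ 0 → ∀ μ : ℝ, 0 ≤ μ →
      F x (t • p) (μ • X) = |t| ^ α * μ * F x p X

/-- Hypothesis (H2): uniform ellipticity. -/
def H2 (Ω : Set (EucSp N)) (F : EucSp N → EucSp N → MatN N → ℝ) (α a A : ℝ) : Prop :=
  0 < a ∧ a ≤ A ∧
    ∀ x ∈ Ω, ∀ p : EucSp N, p ≠ 0 → ∀ M P : MatN N, M.IsSymm → P.IsSymm → P.PosSemidef →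
      a * ‖p‖ ^ α * P.trace ≤ F x p (M + P) - F x p M ∧
        F x p (M + P) - F x p M ≤ A * ‖p‖ ^ α * P.trace

/-- Hypothesis (H3): continuity estimate for doubled variables. -/
def H3 (Ω : Set (EucSp N)) (F : EucSp N → EucSp N → MatN N → ℝ) : Prop :=
  ∃ ω : ℝ → ℝ, Continuous ω ∧ ω 0 = 0 ∧
    ∀ X Y : MatN N, X.IsSymm → Y.IsSymm → ∀ ζ : ℝ, 0 < ζ →
      (Matrix.fromBlocks X 0 0 Y +
        ζ • (1 : Matrix (Fin N ⊕ Fin N) (Fin N ⊕ Fin N) ℝ)).PosSemidef →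
      ((4 * ζ) • Matrix.fromBlocks (1 : MatN N) (-1) (-1) (1 : MatN N) -
        Matrix.fromBlocks X 0 0 Y).PosSemidef →
      ∀ x ∈ Ω, ∀ y ∈ Ω, x ≠ y →
        F x (ζ • (x - y)) X - F y (ζ • (x - y)) (-Y) ≤ ω (ζ * ‖x - y‖ ^ 2)

/-- Frobenius norm of a matrix. -/
noncomputable def frobNorm (X : MatN N) : ℝ := Real.sqrt (∑ i, ∑ j, (X i j) ^ 2)

/-- Hypothesis (H4): Hölder-type continuity of `F` in `x`. -/
def H4 (Ω : Set (EucSp N)) (F : EucSp N → EucSp N → MatN N → ℝ) (α : ℝ) : Prop :=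
  ∃ ω' : ℝ → ℝ, Continuous ω' ∧ ω' 0 = 0 ∧
    ∀ x ∈ Ω, ∀ y ∈ Ω, ∀ p : EucSp N, p ≠ 0 → ∀ X : MatN N, X.IsSymm →
      |F x p X - F y p X| ≤ ω' ‖x - y‖ * ‖p‖ ^ α * frobNorm X

/-- Hypothesis (H5): regularity of `h`. -/
def H5 (Ω : Set (EucSp N)) (T : ℝ) (h : EucSp N → ℝ → EucSp N) (α : ℝ) : Prop :=
  ∃ ωh : ℝ, 0 < ωh ∧ ωh ≤ 1 ∧ ∃ ch : ℝ, 0 < ch ∧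
    (∀ x ∈ Ω, ∀ t ∈ Set.Ioo (0 : ℝ) T, ∀ s ∈ Set.Ioo (0 : ℝ) T,
      ‖h x t - h x s‖ ≤ ch * |t - s| ^ ωh) ∧
    (α ≤ 0 → ∀ x ∈ Ω, ∀ y ∈ Ω, ∀ t ∈ Set.Ioo (0 : ℝ) T,
      ‖h x t - h y t‖ ≤ ch * ‖x - y‖ ^ (1 + α)) ∧
    (0 < α → ∀ x ∈ Ω, ∀ y ∈ Ω, ∀ t ∈ Set.Ioo (0 : ℝ) T,
      ⟪h x t - h y t, x - y⟫ ≤ 0)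

/-- Hypothesis (H6): uniform Lipschitz-type condition on `F` in the gradient variable. -/
def H6 (F : EucSp N → EucSp N → MatN N → ℝ) (α : ℝ) : Prop :=
  ∃ C : ℝ, 0 < C ∧ ∀ x : EucSp N, ∀ p : EucSp N, p ≠ 0 → ∀ q : EucSp N, ‖q‖ < ‖p‖ / 2 →
    ∀ X : MatN N, X.IsSymm →
      |F x (p + q) X - F x p X| ≤ C * ‖p‖ ^ (α - 1) * ‖q‖ * frobNorm X

/-- `h` is continuous and bounded on `Ω × (0,T)`. -/
def HContBdd (Ω : Set (EucSp N)) (T : ℝ) (h : EucSp N → ℝ → EucSp N) : Prop :=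
  ContinuousOn (fun p : EucSp N × ℝ => h p.1 p.2) (Ω ×ˢ Set.Ioo 0 T) ∧
    ∃ C : ℝ, ∀ x ∈ Ω, ∀ t ∈ Set.Ioo (0 : ℝ) T, ‖h x t‖ ≤ C

/-- Uniform exterior cone condition. -/
def UnifExtCone (Ω : Set (EucSp N)) : Prop :=
  ∃ φ₀ ∈ Set.Ioo (0 : ℝ) Real.pi, ∃ r : ℝ, 0 < r ∧
    ∀ z ∈ frontier Ω, ∃ n : EucSp N, ‖n‖ = 1 ∧
      {x : EucSp N | ⟪x - z, n⟫ ≤ Real.cos φ₀ * ‖x - z‖} ∩ closure Ω ∩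
        Metric.ball z r = {z}

/-- `u = ψ` on the parabolic boundary `(∂Ω × (0,T)) ∪ (Ω × {0})`. -/
def BoundaryEq (Ω : Set (EucSp N)) (T : ℝ) (u ψ : EucSp N → ℝ → ℝ) : Prop :=
  (∀ x ∈ frontier Ω, ∀ t ∈ Set.Ioo (0 : ℝ) T, u x t = ψ x t) ∧
    (∀ x ∈ Ω, u x 0 = ψ x 0)

/-- The global barrier family of Proposition 1 of the paper, with Hölder
exponent `γ` and constants `c₁ ≤ W_z(x)/|x-z|^γ ≤ c₂`. -/
def IsBarrierFamily (Ω : Set (EucSp N)) (T : ℝ) (F : EucSp N → EucSp N → MatN N → ℝ)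
    (h : EucSp N → ℝ → EucSp N) (α γ c₁ c₂ : ℝ) : Prop :=
  γ ∈ Set.Ioo (0 : ℝ) 1 ∧ 0 < c₁ ∧ 0 < c₂ ∧
    ∀ z ∈ frontier Ω, ∃ W : EucSp N → ℝ,
      ContinuousOn W (closure Ω) ∧ W z = 0 ∧
      (∀ x ∈ Ω, x ≠ z → 0 < W x) ∧
      (∀ x ∈ Ω, gradient W x ≠ 0) ∧
      (∀ x ∈ Ω, c₁ * ‖x - z‖ ^ γ ≤ W x ∧ W x ≤ c₂ * ‖x - z‖ ^ γ) ∧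
      (∀ x₀ ∈ Ω, ∀ φ : EucSp N → ℝ, ContDiff ℝ 2 φ →
        (∀ᶠ x in nhds x₀, φ x ≤ W x) → φ x₀ = W x₀ → gradient φ x₀ ≠ 0 →
        ∀ t ∈ Set.Ioo (0 : ℝ) T,
          F x₀ (gradient φ x₀) (hessMat φ x₀) + gradTerm h α x₀ t (gradient φ x₀) ≤ -1)

/-- `ψ` is `γ`-Hölder in `x` (with constant `cψ`) and Lipschitz in `t`
(with constant `Lψ`). -/
def PsiHolderLip (Ω : Set (EucSp N)) (T γ cψ Lψ : ℝ) (ψ : EucSp N → ℝ → ℝ) : Prop :=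
  (∀ x ∈ closure Ω, ∀ y ∈ closure Ω, ∀ t ∈ Set.Icc (0 : ℝ) T,
      |ψ x t - ψ y t| ≤ cψ * ‖x - y‖ ^ γ) ∧
    (∀ x ∈ closure Ω, ∀ t ∈ Set.Icc (0 : ℝ) T, ∀ s ∈ Set.Icc (0 : ℝ) T,
      |ψ x t - ψ x s| ≤ Lψ * |t - s|)

/-- A continuous viscosity solution of the problem `1_{f,ψ}` on a bounded domain. -/
def IsSolution (Ω : Set (EucSp N)) (T : ℝ) (F : EucSp N → EucSp N → MatN N → ℝ)
    (h : EucSp N → ℝ → EucSp N) (α : ℝ) (f : EucSp N → ℝ → ℝ)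
    (ψ : EucSp N → ℝ → ℝ) (u : EucSp N → ℝ → ℝ) : Prop :=
  ContinuousOn (fun p : EucSp N × ℝ => u p.1 p.2) (closure Ω ×ˢ Set.Icc 0 T) ∧
    IsSubSol Ω T F h α f u ∧ IsSuperSol Ω T F h α f u ∧ BoundaryEq Ω T u ψ

/-- A quadratic polynomial in the squared distance to `y`. -/
def radialQuad (y : EucSp N) (c b e s : ℝ) (x : EucSp N) : ℝ :=
  c + b * (‖x - y‖ ^ 2 - s) + e * (‖x - y‖ ^ 2 - s) ^ 2

lemma hasFDerivAt_radialQuad (y : EucSp N) (c b e s : ℝ) (x : EucSp N) :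
    HasFDerivAt (radialQuad y c b e s)
      ((2 * (b + 2 * e * (‖x - y‖ ^ 2 - s))) • innerSL ℝ (x - y)) x := by
  have h1 : HasFDerivAt (fun x : EucSp N => ‖x - y‖ ^ 2 - s) (2 • innerSL ℝ (x - y)) x := by
    simpa using (((hasFDerivAt_id x).sub_const y).norm_sq).sub_const s
  have h2 := ((h1.const_mul b).const_add c).add ((h1.pow 2).const_mul e)
  refine h2.congr_fderiv ?_
  ext v
  simp
  ring

lemma gradient_radialQuad (y : EucSp N) (c b e : ℝ) (x : EucSp N) :
    gradient (radialQuad y c b e (‖x - y‖ ^ 2)) x = (2 * b) • (x - y) := by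
  refine HasGradientAt.gradient ?_
  rw [hasGradientAt_iff_hasFDerivAt]
  refine (hasFDerivAt_radialQuad y c b e (‖x - y‖ ^ 2) x).congr_fderiv ?_
  ext v
  simp

lemma hessMat_radialQuad (y : EucSp N) (c b e : ℝ) (x : EucSp N) :
    hessMat (radialQuad y c b e (‖x - y‖ ^ 2)) x =
      (2 * b) • (1 : MatN N) +
        (8 * e) • Matrix.vecMulVec (x - y : EucSp N).ofLp (x - y : EucSp N).ofLp := by
  have hfd : fderiv ℝ (radialQuad y c b e (‖x - y‖ ^ 2)) = fun z =>
      (2 * (b + 2 * e * (‖z - y‖ ^ 2 - ‖x - y‖ ^ 2))) • innerSL ℝ (z - y) :=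
    funext fun z => (hasFDerivAt_radialQuad y c b e _ z).fderiv
  have h1 : HasFDerivAt (fun z : EucSp N => 2 * (b + 2 * e * (‖z - y‖ ^ 2 - ‖x - y‖ ^ 2)))
      ((8 * e) • innerSL ℝ (x - y)) x := by
    have h0 : HasFDerivAt (fun z : EucSp N => ‖z - y‖ ^ 2 - ‖x - y‖ ^ 2)
        (2 • innerSL ℝ (x - y)) x := by
      simpa using (((hasFDerivAt_id x).sub_const y).norm_sq).sub_const (‖x - y‖ ^ 2)
    refine (((h0.const_mul (2 * e)).const_add b).const_mul 2).congr_fderiv ?_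
    ext v
    simp
    ring
  have h2 : HasFDerivAt (fun z : EucSp N => innerSL ℝ (z - y)) (innerSL ℝ) x := by
    have := (innerSL ℝ (E := EucSp N)).hasFDerivAt (x := x - y)
    exact this.comp x ((hasFDerivAt_id x).sub_const y)
  have h3 := (h1.fun_smul h2).fderiv
  ext i j
  change iteratedFDeriv ℝ 2 _ x _ = _
  rw [iteratedFDeriv_two_apply, hfd, h3]
  change 2 * (b + 2 * e * (‖x - y‖ ^ 2 - ‖x - y‖ ^ 2)) *
      ⟪EuclideanSpace.single i (1 : ℝ), EuclideanSpace.single j (1 : ℝ)⟫ +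
    8 * e * ⟪x - y, EuclideanSpace.single i (1 : ℝ)⟫ * ⟪x - y, EuclideanSpace.single j (1 : ℝ)⟫ =
    2 * b * (1 : MatN N) i j + 8 * e * ((x - y).ofLp i * (x - y).ofLp j)
  rw [EuclideanSpace.inner_single_right, EuclideanSpace.inner_single_right,
    EuclideanSpace.inner_single_right]
  simp [Matrix.one_apply, eq_comm (a := i)]
  ring

lemma trace_radialHess (z : EucSp N) (b e : ℝ) :
    ((2 * b) • (1 : MatN N) + (8 * e) • Matrix.vecMulVec z.ofLp z.ofLp).trace =
      2 * b * N + 8 * e * ‖z‖ ^ 2 := by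
  rw [Matrix.trace_add, Matrix.trace_smul, Matrix.trace_smul, Matrix.trace_one,
    Matrix.trace_vecMulVec, EuclideanSpace.norm_sq_eq]
  simp [dotProduct, sq]

lemma posSemidef_radialHess (z : EucSp N) {b e : ℝ} (hb : 0 ≤ b) (he : 0 ≤ e) :
    ((2 * b) • (1 : MatN N) + (8 * e) • Matrix.vecMulVec z.ofLp z.ofLp).PosSemidef := by
  refine (Matrix.PosSemidef.one.smul (by positivity)).add (Matrix.PosSemidef.smul ?_ (by positivity))
  simpa using Matrix.posSemidef_vecMulVec_self_star z.ofLp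

lemma contDiff_radialQuad (y : EucSp N) (c b e s : ℝ) :
    ContDiff ℝ 2 (radialQuad y c b e s) := by
  have h1 : ContDiff ℝ 2 fun x : EucSp N => ‖x - y‖ ^ 2 - s :=
    ((contDiff_id.sub contDiff_const).norm_sq ℝ).sub contDiff_const
  exact (contDiff_const.add (contDiff_const.mul h1)).add (contDiff_const.mul (h1.pow 2))

/-- Near `1`, the power `x ^ m` lies below an explicit quadratic polynomial touching it at `1`. -/
lemma rpow_le_quadratic {m x : ℝ} (hx : 0 < x) (hm : 0 ≤ m) (h : |m * (x - 1)| ≤ 1) :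
    x ^ m ≤ 1 + m * (x - 1) + m ^ 2 * (x - 1) ^ 2 := by
  have h1 := Real.log_le_sub_one_of_pos hx
  have h2 := (abs_le.mp (Real.abs_exp_sub_one_sub_id_le h)).2
  have h3 : x ^ m ≤ Real.exp (m * (x - 1)) := by
    rw [Real.rpow_def_of_pos hx, Real.exp_le_exp]
    nlinarith
  nlinarith

lemma norm_rpow_eventually_le_radialQuad (y x₀ : EucSp N) (hne : x₀ ≠ y) {k : ℝ} (hk : 0 ≤ k) :
    ∀ᶠ x in nhds x₀, ‖x - y‖ ^ k ≤ radialQuad y (‖x₀ - y‖ ^ k)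
      (k / 2 * ‖x₀ - y‖ ^ (k - 2)) ((k / 2) ^ 2 * ‖x₀ - y‖ ^ (k - 4)) (‖x₀ - y‖ ^ 2) x := by
  have hr : 0 < ‖x₀ - y‖ := norm_pos_iff.mpr (sub_ne_zero.mpr hne)
  set r := ‖x₀ - y‖ with hrdef
  have hc : ContinuousAt (fun x : EucSp N => |k / 2 * (‖x - y‖ ^ 2 / r ^ 2 - 1)|) x₀ := by
    fun_prop (disch := positivity)
  have h1 : ∀ᶠ x in nhds x₀, |k / 2 * (‖x - y‖ ^ 2 / r ^ 2 - 1)| < 1 := by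
    refine hc.eventually_lt continuousAt_const ?_
    rw [← hrdef, div_self (by positivity)]
    simp
  have h2 : ∀ᶠ x in nhds x₀, x ≠ y := isOpen_ne.mem_nhds hne
  filter_upwards [h1, h2] with x hx hxy
  have hx0 : 0 < ‖x - y‖ := norm_pos_iff.mpr (sub_ne_zero.mpr hxy)
  have h3 := rpow_le_quadratic (x := ‖x - y‖ ^ 2 / r ^ 2) (m := k / 2) (by positivity)
    (by positivity) hx.le
  have h4 : (‖x - y‖ ^ 2 / r ^ 2) ^ (k / 2) = ‖x - y‖ ^ k / r ^ k := by
    rw [Real.div_rpow (by positivity) (by positivity), ← Real.rpow_natCast, ← Real.rpow_natCast,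
      ← Real.rpow_mul hx0.le, ← Real.rpow_mul hr.le]
    congr 2 <;> push_cast <;> ring
  rw [h4, div_le_iff₀ (by positivity)] at h3
  refine h3.trans (le_of_eq ?_)
  have h5 : r ^ (k - 2) = r ^ k / r ^ 2 := by
    rw [Real.rpow_sub hr]; norm_cast
  have h6 : r ^ (k - 4) = r ^ k / r ^ 4 := by
    rw [Real.rpow_sub hr]; norm_cast
  rw [radialQuad, h5, h6]
  field_simp

lemma H1.apply_zero {Ω : Set (EucSp N)} {F : EucSp N → EucSp N → MatN N → ℝ} {α : ℝ}
    (hF1 : H1 Ω F α) {x p : EucSp N} (hx : x ∈ Ω) (hp : p ≠ 0) : F x p 0 = 0 := by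
  simpa using hF1 x hx p hp 0 Matrix.isSymm_zero 1 one_ne_zero 0 le_rfl

lemma H2.apply_le {Ω : Set (EucSp N)} {F : EucSp N → EucSp N → MatN N → ℝ} {α a A : ℝ}
    (hF2 : H2 Ω F α a A) (hF1 : H1 Ω F α) {x p : EucSp N} (hx : x ∈ Ω) (hp : p ≠ 0)
    {X : MatN N} (hX : X.PosSemidef) : F x p X ≤ A * ‖p‖ ^ α * X.trace := by
  have h := (hF2.2.2 x hx p hp 0 X Matrix.isSymm_zero (by simpa using hX.isHermitian) hX).2
  rwa [zero_add, hF1.apply_zero hx hp, sub_zero] at h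

lemma H2.le_apply_neg {Ω : Set (EucSp N)} {F : EucSp N → EucSp N → MatN N → ℝ} {α a A : ℝ}
    (hF2 : H2 Ω F α a A) (hF1 : H1 Ω F α) {x p : EucSp N} (hx : x ∈ Ω) (hp : p ≠ 0)
    {X : MatN N} (hX : X.PosSemidef) : -(A * ‖p‖ ^ α * X.trace) ≤ F x p (-X) := by
  have hs : X.IsSymm := by simpa using hX.isHermitian
  have h := (hF2.2.2 x hx p hp (-X) X hs.neg hs hX).2
  rw [neg_add_cancel, hF1.apply_zero hx hp] at h
  linarith

/-- Bound for the elliptic operator applied to `K‖x - y‖ ^ k` when `k (α + 1) ≥ α + 2`. -/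
lemma exists_radial_operator_bound {α k A D H n : ℝ} (hk : 1 ≤ k)
    (hkα : α + 2 ≤ k * (α + 1)) (hA : 0 ≤ A) (hD : 0 < D) (hH : 0 ≤ H) (hn : 0 ≤ n) :
    ∃ c : ℝ, 0 ≤ c ∧ ∀ K > 0, ∀ r > 0, r ≤ D →
      A * (2 * (K * (k / 2 * r ^ (k - 2))) * r) ^ α *
          (2 * (K * (k / 2 * r ^ (k - 2))) * n +
            8 * (K * ((k / 2) ^ 2 * r ^ (k - 4))) * r ^ 2) +
        H * (2 * (K * (k / 2 * r ^ (k - 2))) * r) ^ (α + 1) ≤ c * K ^ (α + 1) := by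
  have hk0 : 0 < k := by linarith
  refine ⟨A * k ^ α * (k * n + 2 * k ^ 2) * D ^ (k * (α + 1) - (α + 2)) +
    H * k ^ (α + 1) * D ^ ((k - 1) * (α + 1)), by positivity, fun K hK r hr hrD => ?_⟩
  have e1 : r ^ (k - 2) * r = r ^ (k - 1) := by
    rw [← Real.rpow_add_one hr.ne']; congr 1; ring
  have e2 : r ^ (k - 4) * r ^ 2 = r ^ (k - 2) := by
    rw [← Real.rpow_natCast, ← Real.rpow_add hr]; congr 1; push_cast; ring
  have e3 : 2 * (K * (k / 2 * r ^ (k - 2))) * r = K * k * r ^ (k - 1) := by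
    rw [← e1]; ring
  have e4 : 2 * (K * (k / 2 * r ^ (k - 2))) * n + 8 * (K * ((k / 2) ^ 2 * r ^ (k - 4))) * r ^ 2
      = K * (k * n + 2 * k ^ 2) * r ^ (k - 2) := by
    rw [← e2]; ring
  have e5 : ∀ β : ℝ, (K * k * r ^ (k - 1)) ^ β = K ^ β * k ^ β * r ^ ((k - 1) * β) := fun β => by
    rw [Real.mul_rpow (by positivity) (by positivity), Real.mul_rpow hK.le hk0.le,
      Real.rpow_mul hr.le]
  have e6 : r ^ ((k - 1) * α) * r ^ (k - 2) = r ^ (k * (α + 1) - (α + 2)) := by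
    rw [← Real.rpow_add hr]; congr 1; ring
  have e7 : K ^ α * K = K ^ (α + 1) := (Real.rpow_add_one hK.ne' α).symm
  rw [e3, e4, e5, e5]
  calc A * (K ^ α * k ^ α * r ^ ((k - 1) * α)) * (K * (k * n + 2 * k ^ 2) * r ^ (k - 2)) +
        H * (K ^ (α + 1) * k ^ (α + 1) * r ^ ((k - 1) * (α + 1)))
      = (A * k ^ α * (k * n + 2 * k ^ 2) * r ^ (k * (α + 1) - (α + 2)) +
        H * k ^ (α + 1) * r ^ ((k - 1) * (α + 1))) * K ^ (α + 1) := by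
        rw [← e6, ← e7]; ring
    _ ≤ _ := by
        gcongr
        linarith

/-- Upper bound for the time derivative of smooth functions of time at points where
`w - g - K‖x - y‖ ^ k` has a local maximum off the vertex `y`. -/
def RadialTimeBound (Ω : Set (EucSp N)) (T α k c M : ℝ) (w : EucSp N → ℝ → ℝ) : Prop :=
  ∀ K > 0, ∀ y ∈ Ω, ∀ x₀ ∈ Ω, x₀ ≠ y → ∀ t₀ ∈ Ioo 0 T, ∀ g : ℝ → ℝ, ContDiff ℝ 2 g →
    (∀ᶠ p : EucSp N × ℝ in nhds (x₀, t₀),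
      w p.1 p.2 - g p.2 - K * ‖p.1 - y‖ ^ k ≤ w x₀ t₀ - g t₀ - K * ‖x₀ - y‖ ^ k) →
    deriv g t₀ ≤ c * K ^ (α + 1) + M

/-- Upper bound for the time derivative of smooth functions of time at degenerate maxima of
`w - g`. -/
def DegenerateTimeBound (Ω : Set (EucSp N)) (T M : ℝ) (w : EucSp N → ℝ → ℝ) : Prop :=
  ∀ x₀ ∈ Ω, ∀ t₀ ∈ Ioo 0 T, ∀ δ > 0, Ioo (t₀ - δ) (t₀ + δ) ⊆ Ioo 0 T →
    ∀ g : ℝ → ℝ, ContDiff ℝ 2 g → g t₀ = 0 →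
    (∀ t ∈ Ioo (t₀ - δ) (t₀ + δ), w x₀ t - g t ≤ w x₀ t₀) →
    (∀ᶠ x in nhds x₀, sSup ((fun t => w x t - g t) '' Ioo (t₀ - δ) (t₀ + δ)) =
      sSup ((fun t => w x₀ t - g t) '' Ioo (t₀ - δ) (t₀ + δ))) →
    deriv g t₀ ≤ M

lemma continuousAt_of_mem_cylinder {Ω : Set (EucSp N)} (hΩo : IsOpen Ω) {T : ℝ}
    {u : EucSp N → ℝ → ℝ}
    (hu : ContinuousOn (fun p : EucSp N × ℝ => u p.1 p.2) (closure Ω ×ˢ Icc 0 T))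
    {x : EucSp N} (hx : x ∈ Ω) {t : ℝ} (ht : t ∈ Ioo 0 T) :
    ContinuousAt (fun p : EucSp N × ℝ => u p.1 p.2) (x, t) :=
  hu.continuousAt (prod_mem_nhds (mem_of_superset (hΩo.mem_nhds hx) subset_closure)
    (Icc_mem_nhds ht.1 ht.2))

lemma uscEnv_eq {u : EucSp N → ℝ → ℝ} {x : EucSp N} {t : ℝ}
    (h : ContinuousAt (fun p : EucSp N × ℝ => u p.1 p.2) (x, t)) : uscEnv u x t = u x t :=
  h.tendsto.limsup_eq

lemma lscEnv_eq {u : EucSp N → ℝ → ℝ} {x : EucSp N} {t : ℝ}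
    (h : ContinuousAt (fun p : EucSp N × ℝ => u p.1 p.2) (x, t)) : lscEnv u x t = u x t :=
  h.tendsto.liminf_eq

lemma cylinder_mem_nhds {Ω : Set (EucSp N)} (hΩo : IsOpen Ω) {T : ℝ} {x : EucSp N} (hx : x ∈ Ω)
    {t : ℝ} (ht : t ∈ Ioo 0 T) : Ω ×ˢ Ioo 0 T ∈ nhds (x, t) :=
  prod_mem_nhds (hΩo.mem_nhds hx) (isOpen_Ioo.mem_nhds ht)

lemma IsSubSol.degenerateTimeBound {Ω : Set (EucSp N)} (hΩo : IsOpen Ω) {T α M : ℝ}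
    {F : EucSp N → EucSp N → MatN N → ℝ} {h : EucSp N → ℝ → EucSp N} {f u : EucSp N → ℝ → ℝ}
    (hfb : ∀ x ∈ Ω, ∀ t ∈ Ioo 0 T, |f x t| ≤ M)
    (huc : ContinuousOn (fun p : EucSp N × ℝ => u p.1 p.2) (closure Ω ×ˢ Icc 0 T))
    (hu : IsSubSol Ω T F h α f u) : DegenerateTimeBound Ω T M u := by
  intro x₀ hx₀ t₀ ht₀ δ hδ hW g hg hg0 hmax hconst
  have henv : ∀ x ∈ Ω, ∀ t ∈ Ioo 0 T, uscEnv u x t = u x t := fun x hx t ht =>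
    uscEnv_eq (continuousAt_of_mem_cylinder hΩo huc hx ht)
  have himg : ∀ x ∈ Ω, (fun t => uscEnv u x t - g t) '' Ioo (t₀ - δ) (t₀ + δ) =
      (fun t => u x t - g t) '' Ioo (t₀ - δ) (t₀ + δ) := fun x hx =>
    image_congr fun t ht => by simp only [henv x hx t (hW ht)]
  refine ((hu x₀ hx₀ t₀ ht₀).2 δ hδ g hg hg0 (fun t ht => ?_) ?_).trans
    (abs_le.mp (hfb x₀ hx₀ t₀ ht₀)).2
  · rw [henv x₀ hx₀ t (hW ht), henv x₀ hx₀ t₀ ht₀]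
    exact hmax t ht
  · filter_upwards [hconst, hΩo.mem_nhds hx₀] with x hx hxΩ
    rw [himg x hxΩ, himg x₀ hx₀, hx]

lemma IsSuperSol.degenerateTimeBound_neg {Ω : Set (EucSp N)} (hΩo : IsOpen Ω) {T α M : ℝ}
    {F : EucSp N → EucSp N → MatN N → ℝ} {h : EucSp N → ℝ → EucSp N} {f u : EucSp N → ℝ → ℝ}
    (hfb : ∀ x ∈ Ω, ∀ t ∈ Ioo 0 T, |f x t| ≤ M)
    (huc : ContinuousOn (fun p : EucSp N × ℝ => u p.1 p.2) (closure Ω ×ˢ Icc 0 T))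
    (hu : IsSuperSol Ω T F h α f u) : DegenerateTimeBound Ω T M (fun x t => -u x t) := by
  intro x₀ hx₀ t₀ ht₀ δ hδ hW g hg hg0 hmax hconst
  have henv : ∀ x ∈ Ω, ∀ t ∈ Ioo 0 T, lscEnv u x t = u x t := fun x hx t ht =>
    lscEnv_eq (continuousAt_of_mem_cylinder hΩo huc hx ht)
  have himg : ∀ x ∈ Ω, sInf ((fun t => lscEnv u x t - -g t) '' Ioo (t₀ - δ) (t₀ + δ)) =
      -sSup ((fun t => -u x t - g t) '' Ioo (t₀ - δ) (t₀ + δ)) := fun x hx => by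
    rw [Real.sInf_def, ← image_neg_eq_neg, image_image]
    congr 2
    refine image_congr fun t ht => ?_
    rw [henv x hx t (hW ht)]
    ring
  have key := (hu x₀ hx₀ t₀ ht₀).2 δ hδ (fun t => -g t) hg.neg (by simp [hg0]) (fun t ht => ?_) ?_
  · have h1 := (abs_le.mp (hfb x₀ hx₀ t₀ ht₀)).1
    rw [deriv.fun_neg] at key
    linarith
  · rw [henv x₀ hx₀ t (hW ht), henv x₀ hx₀ t₀ ht₀]
    linarith [hmax t ht]
  · filter_upwards [hconst, hΩo.mem_nhds hx₀] with x hx hxΩ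
    rw [himg x hxΩ, himg x₀ hx₀, hx]

lemma contDiff_radialQuad_time (y : EucSp N) {g : ℝ → ℝ} (hg : ContDiff ℝ 2 g) (b e s : ℝ) :
    ContDiff ℝ 2 fun p : EucSp N × ℝ => radialQuad y (g p.2) b e s p.1 := by
  have h := (hg.comp contDiff_snd).add
    ((contDiff_radialQuad y 0 b e s).comp (contDiff_fst (F := ℝ)))
  convert h using 1
  funext p
  simp only [Function.comp, radialQuad]
  ring

lemma deriv_radialQuad_time (y : EucSp N) (g : ℝ → ℝ) (b e s : ℝ) (x : EucSp N) (t : ℝ) :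
    deriv (fun τ => radialQuad y (g τ) b e s x) t = deriv g t := by
  simp only [radialQuad, deriv_add_const]

lemma inner_mul_rpow_le {v p : EucSp N} {H α : ℝ} (hv : ‖v‖ ≤ H) (hp : p ≠ 0) :
    |⟪v, p⟫ * ‖p‖ ^ α| ≤ H * ‖p‖ ^ (α + 1) := by
  have hp' : 0 < ‖p‖ := norm_pos_iff.mpr hp
  rw [abs_mul, abs_of_nonneg (by positivity : 0 ≤ ‖p‖ ^ α), Real.rpow_add_one hp'.ne']
  calc |⟪v, p⟫| * ‖p‖ ^ α ≤ (H * ‖p‖) * ‖p‖ ^ α := by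
        gcongr
        exact (abs_real_inner_le_norm v p).trans (by gcongr)
    _ = _ := by ring

section Touching

variable {Ω : Set (EucSp N)} {T α k a A D H M c : ℝ} {F : EucSp N → EucSp N → MatN N → ℝ}
  {h : EucSp N → ℝ → EucSp N} {f u : EucSp N → ℝ → ℝ}

lemma IsSubSol.radialTimeBound (hΩo : IsOpen Ω) (hk : 1 ≤ k)
    (hF1 : H1 Ω F α) (hF2 : H2 Ω F α a A) (hH : ∀ x ∈ Ω, ∀ t ∈ Ioo 0 T, ‖h x t‖ ≤ H)
    (hD : ∀ x ∈ Ω, ∀ y ∈ Ω, ‖x - y‖ ≤ D)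
    (hc : ∀ K > 0, ∀ r > 0, r ≤ D →
      A * (2 * (K * (k / 2 * r ^ (k - 2))) * r) ^ α *
          (2 * (K * (k / 2 * r ^ (k - 2))) * N +
            8 * (K * ((k / 2) ^ 2 * r ^ (k - 4))) * r ^ 2) +
        H * (2 * (K * (k / 2 * r ^ (k - 2))) * r) ^ (α + 1) ≤ c * K ^ (α + 1))
    (hfb : ∀ x ∈ Ω, ∀ t ∈ Ioo 0 T, |f x t| ≤ M)
    (huc : ContinuousOn (fun p : EucSp N × ℝ => u p.1 p.2) (closure Ω ×ˢ Icc 0 T))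
    (hu : IsSubSol Ω T F h α f u) : RadialTimeBound Ω T α k c M u := by
  intro K hK y hy x₀ hx₀ hne t₀ ht₀ g hg hmax
  have hz : x₀ - y ≠ 0 := sub_ne_zero.mpr hne
  have hr : 0 < ‖x₀ - y‖ := norm_pos_iff.mpr hz
  have hcr := hc K hK ‖x₀ - y‖ hr (hD x₀ hx₀ y hy)
  have hquad := norm_rpow_eventually_le_radialQuad y x₀ hne (k := k) (by linarith)
  set b := K * (k / 2 * ‖x₀ - y‖ ^ (k - 2)) with hb
  set e := K * ((k / 2) ^ 2 * ‖x₀ - y‖ ^ (k - 4)) with he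
  have hb0 : 0 < b := by positivity
  have he0 : 0 < e := by positivity
  have hp : (2 * b) • (x₀ - y) ≠ 0 := smul_ne_zero (by positivity) hz
  have hpn : ‖(2 * b) • (x₀ - y)‖ = 2 * b * ‖x₀ - y‖ := by
    rw [norm_smul, Real.norm_of_nonneg (by positivity)]
  have key := (hu x₀ hx₀ t₀ ht₀).1
    (fun x t => radialQuad y (g t + (u x₀ t₀ - g t₀)) b e (‖x₀ - y‖ ^ 2) x)
    (contDiff_radialQuad_time y (hg.add contDiff_const) b e _) ?_ ?_ ?_
  · rw [deriv_radialQuad_time y (fun t => g t + (u x₀ t₀ - g t₀)), deriv_add_const,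
      gradient_radialQuad, hessMat_radialQuad] at key
    have h1 := hF2.apply_le hF1 hx₀ hp (posSemidef_radialHess (x₀ - y) hb0.le he0.le)
    have h2 := (abs_le.mp (inner_mul_rpow_le (α := α) (hH x₀ hx₀ t₀ ht₀) hp)).2
    have h3 := (abs_le.mp (hfb x₀ hx₀ t₀ ht₀)).2
    rw [trace_radialHess, hpn] at h1
    rw [gradTerm] at key
    rw [hpn] at h2 key
    linarith
  · filter_upwards [hmax, cylinder_mem_nhds hΩo hx₀ ht₀,
      (continuous_fst.tendsto (x₀, t₀)).eventually hquad] with p hp1 hp2 hp3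
    rw [uscEnv_eq (continuousAt_of_mem_cylinder hΩo huc hp2.1 hp2.2)]
    have := mul_le_mul_of_nonneg_left hp3 hK.le
    simp only [radialQuad] at this ⊢
    rw [hb, he]
    linarith
  · rw [uscEnv_eq (continuousAt_of_mem_cylinder hΩo huc hx₀ ht₀)]
    simp [radialQuad]
  · rw [gradient_radialQuad]
    exact hp

lemma IsSuperSol.radialTimeBound_neg (hΩo : IsOpen Ω) (hk : 1 ≤ k)
    (hF1 : H1 Ω F α) (hF2 : H2 Ω F α a A) (hH : ∀ x ∈ Ω, ∀ t ∈ Ioo 0 T, ‖h x t‖ ≤ H)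
    (hD : ∀ x ∈ Ω, ∀ y ∈ Ω, ‖x - y‖ ≤ D)
    (hc : ∀ K > 0, ∀ r > 0, r ≤ D →
      A * (2 * (K * (k / 2 * r ^ (k - 2))) * r) ^ α *
          (2 * (K * (k / 2 * r ^ (k - 2))) * N +
            8 * (K * ((k / 2) ^ 2 * r ^ (k - 4))) * r ^ 2) +
        H * (2 * (K * (k / 2 * r ^ (k - 2))) * r) ^ (α + 1) ≤ c * K ^ (α + 1))
    (hfb : ∀ x ∈ Ω, ∀ t ∈ Ioo 0 T, |f x t| ≤ M)
    (huc : ContinuousOn (fun p : EucSp N × ℝ => u p.1 p.2) (closure Ω ×ˢ Icc 0 T))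
    (hu : IsSuperSol Ω T F h α f u) : RadialTimeBound Ω T α k c M (fun x t => -u x t) := by
  intro K hK y hy x₀ hx₀ hne t₀ ht₀ g hg hmax
  have hz : x₀ - y ≠ 0 := sub_ne_zero.mpr hne
  have hr : 0 < ‖x₀ - y‖ := norm_pos_iff.mpr hz
  have hcr := hc K hK ‖x₀ - y‖ hr (hD x₀ hx₀ y hy)
  have hquad := norm_rpow_eventually_le_radialQuad y x₀ hne (k := k) (by linarith)
  set b := K * (k / 2 * ‖x₀ - y‖ ^ (k - 2)) with hb
  set e := K * ((k / 2) ^ 2 * ‖x₀ - y‖ ^ (k - 4)) with he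
  have hb0 : 0 < b := by positivity
  have he0 : 0 < e := by positivity
  have hp : (2 * -b) • (x₀ - y) ≠ 0 := smul_ne_zero (by simpa using hb0.ne') hz
  have hpn : ‖(2 * -b) • (x₀ - y)‖ = 2 * b * ‖x₀ - y‖ := by
    rw [norm_smul, Real.norm_eq_abs, mul_neg, abs_neg, abs_of_pos (by positivity)]
  have key := (hu x₀ hx₀ t₀ ht₀).1
    (fun x t => radialQuad y (-g t + (u x₀ t₀ + g t₀)) (-b) (-e) (‖x₀ - y‖ ^ 2) x)
    (contDiff_radialQuad_time y (hg.neg.add contDiff_const) (-b) (-e) _) ?_ ?_ ?_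
  · have hX : (2 * -b) • (1 : MatN N) +
        (8 * -e) • Matrix.vecMulVec (x₀ - y : EucSp N).ofLp (x₀ - y : EucSp N).ofLp =
        -((2 * b) • (1 : MatN N) +
          (8 * e) • Matrix.vecMulVec (x₀ - y : EucSp N).ofLp (x₀ - y : EucSp N).ofLp) := by
      module
    rw [deriv_radialQuad_time y (fun t => -g t + (u x₀ t₀ + g t₀)), deriv_add_const,
      deriv.fun_neg, gradient_radialQuad, hessMat_radialQuad, hX] at key
    have h1 := hF2.le_apply_neg hF1 hx₀ hp (posSemidef_radialHess (x₀ - y) hb0.le he0.le)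
    have h2 := (abs_le.mp (inner_mul_rpow_le (α := α) (hH x₀ hx₀ t₀ ht₀) hp)).1
    have h3 := (abs_le.mp (hfb x₀ hx₀ t₀ ht₀)).1
    rw [trace_radialHess, hpn] at h1
    rw [gradTerm] at key
    rw [hpn] at h2 key
    linarith
  · filter_upwards [hmax, cylinder_mem_nhds hΩo hx₀ ht₀,
      (continuous_fst.tendsto (x₀, t₀)).eventually hquad] with p hp1 hp2 hp3
    rw [lscEnv_eq (continuousAt_of_mem_cylinder hΩo huc hp2.1 hp2.2)]
    have := mul_le_mul_of_nonneg_left hp3 hK.le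
    simp only [radialQuad] at this ⊢
    rw [hb, he]
    linarith
  · rw [lscEnv_eq (continuousAt_of_mem_cylinder hΩo huc hx₀ ht₀)]
    simp [radialQuad]
  · rw [gradient_radialQuad]
    exact hp

end Touching

/-- A function with modulus of continuity `K r ^ k`, `k ≥ 2`, on a ball is constant there. -/
lemma eq_of_le_add_rpow {E : Type*} [NormedAddCommGroup E] [NormedSpace ℝ E] {m : E → ℝ}
    {x₁ : E} {ρ K k : ℝ} (hK : 0 ≤ K) (hk : 2 ≤ k)
    (hm : ∀ x ∈ ball x₁ ρ, ∀ y ∈ ball x₁ ρ, m x ≤ m y + K * ‖x - y‖ ^ k) {x : E}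
    (hx : x ∈ ball x₁ ρ) : m x = m x₁ := by
  have hd : ∀ y ∈ ball x₁ ρ, HasFDerivAt m (0 : E →L[ℝ] ℝ) y := by
    intro y hy
    have hO : (fun x => m x - m y) =O[nhds y] fun x => ‖x - y‖ ^ 2 := by
      refine Asymptotics.IsBigO.of_bound K ?_
      filter_upwards [isOpen_ball.mem_nhds hy, ball_mem_nhds y one_pos] with x hx hxy
      have h1 := hm x hx y hy
      have h2 := hm y hy x hx
      rw [norm_sub_rev y x] at h2
      have h3 : ‖x - y‖ ^ k ≤ ‖x - y‖ ^ 2 := by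
        rw [← Real.rpow_natCast]
        refine Real.rpow_le_rpow_of_exponent_ge' (norm_nonneg _) ?_ (by norm_num)
          (by exact_mod_cast hk)
        rw [← dist_eq_norm]
        exact (mem_ball.mp hxy).le
      have h4 := mul_le_mul_of_nonneg_left h3 hK
      rw [Real.norm_eq_abs, Real.norm_of_nonneg (by positivity), abs_le]
      constructor <;> linarith
    simpa using (hO.hasFDerivAt one_lt_two).add_const (m y)
  refine (convex_ball x₁ ρ).is_const_of_fderivWithin_eq_zero (𝕜 := ℝ)
    (fun y hy => (hd y hy).differentiableAt.differentiableWithinAt) (fun y hy => ?_) hx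
    (mem_ball_self (pos_of_mem_ball hx))
  rw [fderivWithin_of_isOpen isOpen_ball hy, (hd y hy).fderiv]

lemma eventually_forall_mul_rpow_lt {E : Type*} [NormedAddCommGroup E] {S : Set E}
    (hS : IsCompact S) {K k κ : ℝ} (hk : 0 < k) (hκ : 0 < κ) (x₀ : E) :
    ∀ᶠ y in nhds x₀, ∀ x ∈ S, K * ‖x - x₀‖ ^ k < K * ‖x - y‖ ^ k - K * ‖x₀ - y‖ ^ k + κ := by
  refine hS.eventually_forall_of_forall_eventually fun x _ => ?_
  have hpow : ∀ φ : E × E → E, Continuous φ → Continuous fun z => K * ‖φ z‖ ^ k := fun φ hφ =>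
    continuous_const.mul (hφ.norm.rpow_const fun _ => Or.inr hk.le)
  have h1 : Continuous fun z : E × E => K * ‖z.2 - x₀‖ ^ k :=
    hpow (fun z => z.2 - x₀) (by fun_prop)
  have h2 : Continuous fun z : E × E => K * ‖z.2 - z.1‖ ^ k - K * ‖x₀ - z.1‖ ^ k + κ :=
    ((hpow (fun z => z.2 - z.1) (by fun_prop)).sub
      (hpow (fun z => x₀ - z.1) (by fun_prop))).add continuous_const
  refine h1.continuousAt.eventually_lt h2.continuousAt ?_
  simpa [Real.zero_rpow hk.ne'] using hκ

/-- Comparison of a subsolution with the radial barrier `g(t) + K‖x - x₁‖ ^ k`. -/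
lemma le_radial_barrier {Ω : Set (EucSp N)} (hΩo : IsOpen Ω) (hΩb : Bornology.IsBounded Ω)
    {T α k c M : ℝ} {w : EucSp N → ℝ → ℝ} (hk : 2 ≤ k) (hc : 0 ≤ c)
    (hwc : ContinuousOn (fun p : EucSp N × ℝ => w p.1 p.2) (closure Ω ×ˢ Icc 0 T))
    (hrad : RadialTimeBound Ω T α k c M w) (hdeg : DegenerateTimeBound Ω T M w)
    {K : ℝ} (hK : 0 < K) {x₁ : EucSp N} (hx₁ : x₁ ∈ Ω) {g : ℝ → ℝ} (hg : ContDiff ℝ 2 g)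
    (hg' : ∀ t ∈ Ioo 0 T, c * K ^ (α + 1) + M + 1 ≤ deriv g t)
    (hbd : ∀ x ∈ closure Ω, ∀ t ∈ Icc 0 T, (x ∉ Ω ∨ t ∉ Ioo 0 T) →
      w x t - g t - K * ‖x - x₁‖ ^ k ≤ 0)
    {t : ℝ} (ht : t ∈ Ioo 0 T) : w x₁ t ≤ g t := by
  have hk0 : k ≠ 0 := by linarith
  have hT : 0 < T := ht.1.trans ht.2
  have hQ : IsCompact (closure Ω ×ˢ Icc 0 T) := hΩb.isCompact_closure.prod isCompact_Icc
  have hcont : ∀ y : EucSp N, ∀ g₂ : ℝ → ℝ, ContDiff ℝ 2 g₂ →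
      ContinuousOn (fun p : EucSp N × ℝ => w p.1 p.2 - g₂ p.2 - K * ‖p.1 - y‖ ^ k)
        (closure Ω ×ˢ Icc 0 T) := fun y g₂ hg₂ => by
    refine (hwc.sub (hg₂.continuous.comp continuous_snd).continuousOn).sub
      (Continuous.continuousOn ?_)
    exact continuous_const.mul
      ((continuous_fst.sub continuous_const).norm.rpow_const fun _ => Or.inr (by linarith))
  have hvertex : ∀ y ∈ Ω, ∀ g₂ : ℝ → ℝ, ContDiff ℝ 2 g₂ →
      (∀ t ∈ Ioo 0 T, c * K ^ (α + 1) + M < deriv g₂ t) → ∀ p ∈ Ω ×ˢ Ioo 0 T,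
      IsMaxOn (fun p : EucSp N × ℝ => w p.1 p.2 - g₂ p.2 - K * ‖p.1 - y‖ ^ k)
        (closure Ω ×ˢ Icc 0 T) p → p.1 = y := by
    intro y hy g₂ hg₂ hg₂' p hp hmax
    by_contra hne
    refine absurd (hrad K hK y hy p.1 hp.1 hne p.2 hp.2 g₂ hg₂ ?_) (not_le.mpr (hg₂' p.2 hp.2))
    filter_upwards [cylinder_mem_nhds hΩo hp.1 hp.2] with z hz
    exact hmax ⟨subset_closure hz.1, Ioo_subset_Icc_self hz.2⟩
  by_contra! hlt
  obtain ⟨⟨x₀, t₀⟩, hp₀, hmax₀⟩ := hQ.exists_isMaxOn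
    ⟨(x₁, t), subset_closure hx₁, Ioo_subset_Icc_self ht⟩ (hcont x₁ g hg)
  have hpos : 0 < w x₀ t₀ - g t₀ - K * ‖x₀ - x₁‖ ^ k := by
    have h1 := hmax₀ (show (x₁, t) ∈ closure Ω ×ˢ Icc 0 T from
      ⟨subset_closure hx₁, Ioo_subset_Icc_self ht⟩)
    simp only [mem_ofPred_eq, sub_self, norm_zero, Real.zero_rpow hk0, mul_zero] at h1
    linarith
  have hin : ∀ x ∈ closure Ω, ∀ t ∈ Icc 0 T, 0 < w x t - g t - K * ‖x - x₁‖ ^ k →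
      x ∈ Ω ∧ t ∈ Ioo 0 T := by
    intro x hx t ht h1
    by_contra h2
    exact absurd (hbd x hx t ht (not_and_or.mp h2)) (not_le.mpr h1)
  obtain ⟨hx₀, ht₀⟩ := hin x₀ hp₀.1 t₀ hp₀.2 hpos
  obtain rfl : x₀ = x₁ := hvertex x₁ hx₁ g hg (fun t ht => by linarith [hg' t ht]) (x₀, t₀)
    ⟨hx₀, ht₀⟩ hmax₀
  have hmax : ∀ x ∈ closure Ω, ∀ t ∈ Icc 0 T,
      w x t - g t - K * ‖x - x₀‖ ^ k ≤ w x₀ t₀ - g t₀ := by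
    intro x hx t ht
    have := hmax₀ (show (x, t) ∈ closure Ω ×ˢ Icc 0 T from ⟨hx, ht⟩)
    simpa [Real.zero_rpow hk0] using this
  simp only [sub_self, norm_zero, Real.zero_rpow hk0, mul_zero, sub_zero] at hpos
  -- Penalise the time variable so that the maximum is strict in time.
  set g₂ : ℝ → ℝ := fun t => g t + 1 / (4 * T) * (t - t₀) ^ 2 with hg₂def
  have hg₂ : ContDiff ℝ 2 g₂ := by fun_prop
  have hg₂d : ∀ t, deriv g₂ t = deriv g t + (t - t₀) / (2 * T) := fun t => by
    have h1 : HasDerivAt g (deriv g t) t := (hg.differentiable (by norm_num) t).hasDerivAt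
    have h2 := h1.add ((((hasDerivAt_id t).sub_const t₀).pow 2).const_mul (1 / (4 * T)))
    refine h2.deriv.trans ?_
    simp
    field_simp
    ring
  have hg₂' : ∀ t ∈ Ioo 0 T, c * K ^ (α + 1) + M < deriv g₂ t := fun t ht => by
    have h1 : -(1 / 2) ≤ (t - t₀) / (2 * T) := by
      rw [le_div_iff₀ (by positivity)]
      linarith [ht.1, ht₀.2]
    rw [hg₂d]
    linarith [hg' t ht]
  obtain ⟨δ, hδ, hW⟩ : ∃ δ > 0, Ioo (t₀ - δ) (t₀ + δ) ⊆ Ioo 0 T := by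
    refine ⟨min t₀ (T - t₀), lt_min ht₀.1 (by linarith [ht₀.2]), fun s hs => ?_⟩
    have h1 := min_le_left t₀ (T - t₀)
    have h2 := min_le_right t₀ (T - t₀)
    exact ⟨by linarith [hs.1], by linarith [hs.2]⟩
  set W := Ioo (t₀ - δ) (t₀ + δ) with hWdef
  have ht₀W : t₀ ∈ W := ⟨by linarith, by linarith⟩
  have hS : IsCompact ((closure Ω ×ˢ Icc 0 T) \ (Ω ×ˢ W)) := hQ.diff (hΩo.prod isOpen_Ioo)
  have hstrict : ∀ p ∈ (closure Ω ×ˢ Icc 0 T) \ (Ω ×ˢ W),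
      w p.1 p.2 - g₂ p.2 - K * ‖p.1 - x₀‖ ^ k < w x₀ t₀ - g t₀ := by
    rintro ⟨x, t⟩ ⟨hp, hpW⟩
    have h0 : 0 ≤ 1 / (4 * T) * (t - t₀) ^ 2 := by positivity
    simp only [hg₂def]
    by_cases hneg : w x t - g t - K * ‖x - x₀‖ ^ k ≤ 0
    · linarith
    · have hne : t - t₀ ≠ 0 := fun h => hpW
        ⟨(hin x hp.1 t hp.2 (not_le.mp hneg)).1, by rw [sub_eq_zero.mp h]; exact ht₀W⟩
      have h1 : 0 < 1 / (4 * T) * (t - t₀) ^ 2 := by positivity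
      linarith [hmax x hp.1 t hp.2]
  obtain ⟨κ, hκ, hgap⟩ : ∃ κ > 0, ∀ p ∈ (closure Ω ×ˢ Icc 0 T) \ (Ω ×ˢ W),
      w p.1 p.2 - g₂ p.2 - K * ‖p.1 - x₀‖ ^ k ≤ w x₀ t₀ - g t₀ - κ := by
    rcases ((closure Ω ×ˢ Icc 0 T) \ (Ω ×ˢ W)).eq_empty_or_nonempty with hem | hne
    · exact ⟨1, one_pos, by simp [hem]⟩
    · obtain ⟨s, hs, hsmax⟩ := hS.exists_isMaxOn hne ((hcont x₀ g₂ hg₂).mono sdiff_subset)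
      exact ⟨_, sub_pos.mpr (hstrict s hs), fun p hp => by linarith [isMaxOn_iff.mp hsmax p hp]⟩
  have htube : ∀ᶠ y in nhds x₀, ∀ x ∈ closure Ω,
      K * ‖x - x₀‖ ^ k < K * ‖x - y‖ ^ k - K * ‖x₀ - y‖ ^ k + κ :=
      eventually_forall_mul_rpow_lt hΩb.isCompact_closure (by linarith) hκ x₀
  obtain ⟨ρ, hρ, hball⟩ := Metric.mem_nhds_iff.mp (htube.and (hΩo.mem_nhds hx₀))
  have hattain : ∀ y ∈ ball x₀ ρ, ∃ s ∈ W, ∀ x ∈ closure Ω, ∀ t ∈ Icc 0 T,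
      w x t - g₂ t - K * ‖x - y‖ ^ k ≤ w y s - g₂ s := by
    intro y hy
    obtain ⟨hyt, hyΩ⟩ := hball hy
    obtain ⟨⟨z, s⟩, hp, hpmax⟩ := hQ.exists_isMaxOn ⟨(x₀, t₀), hp₀⟩ (hcont y g₂ hg₂)
    have hpmax' := isMaxOn_iff.mp hpmax
    have hzW : (z, s) ∈ Ω ×ˢ W := by
      by_contra hnot
      have h1 := hgap (z, s) ⟨hp, hnot⟩
      have h2 := hpmax' (x₀, t₀) hp₀
      have h3 := hyt z hp.1
      have h4 : g₂ t₀ = g t₀ := by simp [hg₂def]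
      simp only at h1 h2
      linarith
    obtain rfl : z = y := hvertex y hyΩ g₂ hg₂ hg₂' (z, s) ⟨hzW.1, hW hzW.2⟩ hpmax
    refine ⟨s, hzW.2, fun x hx t ht => ?_⟩
    simpa [Real.zero_rpow hk0] using hpmax' (x, t) ⟨hx, ht⟩
  have hWIcc : W ⊆ Icc 0 T := hW.trans Ioo_subset_Icc_self
  have hbdd : ∀ y ∈ ball x₀ ρ, BddAbove ((fun t => w y t - (g₂ t - g₂ t₀)) '' W) := by
    intro y hy
    obtain ⟨s, -, hs⟩ := hattain y hy
    refine ⟨w y s - g₂ s + g₂ t₀, ?_⟩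
    rintro _ ⟨t, ht, rfl⟩
    have := hs y (subset_closure (hball hy).2) t (hWIcc ht)
    simp only [sub_self, norm_zero, Real.zero_rpow hk0, mul_zero] at this
    linarith
  have hhol : ∀ x ∈ ball x₀ ρ, ∀ y ∈ ball x₀ ρ,
      sSup ((fun t => w x t - (g₂ t - g₂ t₀)) '' W) ≤
        sSup ((fun t => w y t - (g₂ t - g₂ t₀)) '' W) + K * ‖x - y‖ ^ k := by
    intro x hx y hy
    refine csSup_le ⟨_, mem_image_of_mem _ ht₀W⟩ ?_
    rintro _ ⟨t, ht, rfl⟩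
    obtain ⟨s, hsW, hs⟩ := hattain y hy
    have h1 := hs x (subset_closure (hball hx).2) t (hWIcc ht)
    have h2 := le_csSup (hbdd y hy) (mem_image_of_mem _ hsW)
    linarith
  have hfin := hdeg x₀ hx₀ t₀ ht₀ δ hδ hW (fun t => g₂ t - g₂ t₀) (hg₂.sub contDiff_const)
    (sub_self _) (fun t ht => ?_) ?_
  · rw [deriv_sub_const, hg₂d, sub_self, zero_div, add_zero] at hfin
    have : 0 ≤ c * K ^ (α + 1) := by positivity
    linarith [hg' t₀ ht₀]
  · have h1 := hmax x₀ hp₀.1 t (hWIcc ht)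
    have h2 : 0 ≤ 1 / (4 * T) * (t - t₀) ^ 2 := by positivity
    simp only [sub_self, norm_zero, Real.zero_rpow hk0, mul_zero] at h1
    simp only [hg₂def, sub_self]
    linarith
  · filter_upwards [ball_mem_nhds x₀ hρ] with x hx
    exact eq_of_le_add_rpow hK.le hk hhol hx

/-- Young-type splitting `cψ r ^ γ ≤ ε + K r ^ k` with `K = cψ ^ q ε ^ (1 - q)`, `q = k / γ`. -/
lemma mul_rpow_le_add_mul_rpow {c r γ k q ε : ℝ} (hc : 0 < c) (hr : 0 ≤ r) (hε : 0 < ε)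
    (hq : 1 ≤ q) (hk : γ * q = k) :
    c * r ^ γ ≤ ε + c ^ q * ε ^ (1 - q) * r ^ k := by
  have hy : ∀ y : ℝ, 0 ≤ y → y ≤ 1 + y ^ q := fun y hy => by
    rcases le_total y 1 with h | h
    · linarith [Real.rpow_nonneg hy q]
    · linarith [Real.self_le_rpow_of_one_le h hq]
  have h1 := hy (c * r ^ γ / ε) (by positivity)
  rw [Real.div_rpow (by positivity) hε.le, Real.mul_rpow hc.le (by positivity),
    ← Real.rpow_mul hr, hk, div_le_iff₀ hε] at h1
  refine h1.trans (le_of_eq ?_)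
  rw [Real.rpow_sub hε, Real.rpow_one]
  field_simp

lemma BoundaryEq.le_initial {Ω : Set (EucSp N)} (hΩo : IsOpen Ω) {T γ cψ Lψ : ℝ}
    {w ψ : EucSp N → ℝ → ℝ} (hT : 0 < T)
    (hwc : ContinuousOn (fun p : EucSp N × ℝ => w p.1 p.2) (closure Ω ×ˢ Icc 0 T))
    (hψ : PsiHolderLip Ω T γ cψ Lψ ψ) (hb : BoundaryEq Ω T w ψ) {x₁ : EucSp N} (hx₁ : x₁ ∈ Ω)
    {x : EucSp N} (hx : x ∈ closure Ω) {t : ℝ} (ht0 : 0 ≤ t) (htT : t < T)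
    (hxt : x ∉ Ω ∨ t ∉ Ioo 0 T) :
    w x t ≤ ψ x₁ 0 + cψ * ‖x - x₁‖ ^ γ + Lψ * t := by
  have h0 : (0 : ℝ) ∈ Icc 0 T := ⟨le_rfl, hT.le⟩
  have hspace := (abs_le.mp (hψ.1 x hx x₁ (subset_closure hx₁) 0 h0)).2
  have hlat : ∀ z ∈ closure Ω, z ∉ Ω → ∀ s ∈ Ioo 0 T, w z s ≤ ψ z 0 + Lψ * s := by
    intro z hz hzΩ s hs
    rw [hb.1 z (hΩo.frontier_eq ▸ ⟨hz, hzΩ⟩) s hs]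
    have := (abs_le.mp (hψ.2 z hz s (Ioo_subset_Icc_self hs) 0 h0)).2
    rw [sub_zero, abs_of_pos hs.1] at this
    linarith
  suffices w x t ≤ ψ x 0 + Lψ * t by linarith
  rcases ht0.eq_or_lt with rfl | htpos
  · by_cases hxΩ : x ∈ Ω
    · rw [hb.2 x hxΩ]
      linarith
    · have hw : Tendsto (w x) (nhdsWithin 0 (Ioi 0)) (nhds (w x 0)) := by
        have h1 : ContinuousOn (w x) (Icc 0 T) :=
          hwc.comp (f := fun s => (x, s)) (by fun_prop) fun s hs => ⟨hx, hs⟩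
        exact ((h1 0 h0).mono Ioo_subset_Icc_self).mono_left
          (nhdsWithin_Ioo_eq_nhdsGT hT).ge
      have hr : Tendsto (fun s => ψ x 0 + Lψ * s) (nhdsWithin 0 (Ioi 0))
          (nhds (ψ x 0 + Lψ * 0)) :=
        (Continuous.tendsto (by fun_prop) 0).mono_left nhdsWithin_le_nhds
      refine le_of_tendsto_of_tendsto hw hr ?_
      filter_upwards [Ioo_mem_nhdsGT hT] with s hs using hlat x hx hxΩ s hs
  · exact hlat x hx (hxt.resolve_right fun h => h ⟨htpos, htT⟩) t ⟨htpos, htT⟩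

/-- One-sided estimate with a free parameter `ε`. -/
lemma le_initial_add {Ω : Set (EucSp N)} (hΩo : IsOpen Ω) (hΩb : Bornology.IsBounded Ω)
    {T α k c M γ q cψ Lψ : ℝ} {w ψ : EucSp N → ℝ → ℝ} (hk : 2 ≤ k) (hc : 0 ≤ c) (hM : 0 ≤ M)
    (hcψ : 0 < cψ) (hLψ : 0 ≤ Lψ) (hq : 1 ≤ q) (hkq : γ * q = k)
    (hwc : ContinuousOn (fun p : EucSp N × ℝ => w p.1 p.2) (closure Ω ×ˢ Icc 0 T))
    (hrad : RadialTimeBound Ω T α k c M w) (hdeg : DegenerateTimeBound Ω T M w)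
    (hψ : PsiHolderLip Ω T γ cψ Lψ ψ) (hb : BoundaryEq Ω T w ψ) {x₁ : EucSp N} (hx₁ : x₁ ∈ Ω)
    {τ : ℝ} (hτ : τ ∈ Ioo 0 T) {ε : ℝ} (hε : 0 < ε) :
    w x₁ τ ≤ ψ x₁ 0 + ε + (c * (cψ ^ q * ε ^ (1 - q)) ^ (α + 1) + M + 1 + Lψ) * τ := by
  have hT : 0 < T := hτ.1.trans hτ.2
  set K := cψ ^ q * ε ^ (1 - q) with hKdef
  have hK : 0 < K := by positivity
  set L := c * K ^ (α + 1) + M + 1 + Lψ with hL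
  have hLL : Lψ ≤ L := by
    have : 0 ≤ c * K ^ (α + 1) := by positivity
    linarith
  obtain ⟨B₀, hB₀⟩ := (hΩb.isCompact_closure.prod isCompact_Icc).bddAbove_image hwc
  set B := max 0 (B₀ - ψ x₁ 0) with hB
  have hB0 : 0 ≤ B := le_max_left _ _
  have hn : ∀ n : ℕ, w x₁ τ ≤ ψ x₁ 0 + ε + L * τ + B * (τ / T) ^ n := by
    intro n
    refine le_radial_barrier hΩo hΩb hk hc hwc hrad hdeg hK hx₁
      (g := fun t => ψ x₁ 0 + ε + L * t + B * (t / T) ^ n) (by fun_prop) ?_ ?_ hτ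
    · intro t ht
      have hd := (((hasDerivAt_id t).const_mul L).const_add (ψ x₁ 0 + ε)).add
        ((((hasDerivAt_id t).div_const T).pow n).const_mul B)
      have hd' : deriv (fun t => ψ x₁ 0 + ε + L * t + B * (t / T) ^ n) t = _ := hd.deriv
      rw [hd']
      have ht0 := ht.1
      have : 0 ≤ B * (n * (id t / T) ^ (n - 1) * (1 / T)) := by
        simp only [id]
        positivity
      linarith
    · intro x hx t ht hxt
      have hKr : 0 ≤ K * ‖x - x₁‖ ^ k := by positivity
      have hLt : 0 ≤ L * t := mul_nonneg (hLψ.trans hLL) ht.1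
      rcases ht.2.eq_or_lt with rfl | htT
      · have h1 : w x t ≤ B₀ := hB₀ ⟨(x, t), ⟨hx, ht⟩, rfl⟩
        have h2 : B₀ - ψ x₁ 0 ≤ B := le_max_right _ _
        rw [div_self hT.ne', one_pow]
        linarith
      · have h1 := hb.le_initial hΩo hT hwc hψ hx₁ hx ht.1 htT hxt
        have h2 := mul_rpow_le_add_mul_rpow hcψ (norm_nonneg (x - x₁)) hε hq hkq
        have h3 : 0 ≤ B * (t / T) ^ n := mul_nonneg hB0 (pow_nonneg (div_nonneg ht.1 hT.le) n)
        have h4 := mul_le_mul_of_nonneg_right hLL ht.1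
        linarith
  have hlim : Tendsto (fun n : ℕ => ψ x₁ 0 + ε + L * τ + B * (τ / T) ^ n) atTop
      (nhds (ψ x₁ 0 + ε + L * τ + B * 0)) :=
    ((tendsto_pow_atTop_nhds_zero_of_lt_one (div_nonneg hτ.1.le hT.le)
      ((div_lt_one hT).mpr hτ.2)).const_mul B).const_add _
  simpa using ge_of_tendsto' hlim hn

/-- The choice `ε = t ^ (1 / (q (α + 1) - α))` balances the two terms of the estimate. -/
lemma initial_layer_balance {α q c M T s t : ℝ} (hs : 0 < s) (ht : 0 < t) (htT : t ≤ T)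
    (hM : 0 ≤ M) (hE : 1 ≤ q * (α + 1) - α) :
    t ^ (1 / (q * (α + 1) - α)) +
        (c * (s * (t ^ (1 / (q * (α + 1) - α))) ^ (1 - q)) ^ (α + 1) + M) * t ≤
      (1 + c * s ^ (α + 1) + M * T ^ (1 - 1 / (q * (α + 1) - α))) *
        t ^ (1 / (q * (α + 1) - α)) := by
  set E := q * (α + 1) - α with hEdef
  have hE0 : 0 < E := by linarith
  have h1 : (s * (t ^ (1 / E)) ^ (1 - q)) ^ (α + 1) * t = s ^ (α + 1) * t ^ (1 / E) := by
    rw [Real.mul_rpow hs.le (by positivity), ← Real.rpow_mul ht.le, ← Real.rpow_mul ht.le,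
      mul_assoc, ← Real.rpow_add_one ht.ne']
    congr 2
    field_simp
    rw [hEdef]
    ring
  have h2 : t ≤ T ^ (1 - 1 / E) * t ^ (1 / E) := by
    have h3 : t = t ^ (1 - 1 / E) * t ^ (1 / E) := by
      rw [← Real.rpow_add ht, sub_add_cancel, Real.rpow_one]
    have h4 : t ^ (1 - 1 / E) ≤ T ^ (1 - 1 / E) :=
      Real.rpow_le_rpow ht.le htT (sub_nonneg.mpr ((div_le_one hE0).mpr hE))
    calc t = t ^ (1 - 1 / E) * t ^ (1 / E) := h3
      _ ≤ _ := by gcongr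
  have h5 := mul_le_mul_of_nonneg_left h2 hM
  calc _ = t ^ (1 / E) + c * ((s * (t ^ (1 / E)) ^ (1 - q)) ^ (α + 1) * t) + M * t := by ring
    _ ≤ _ := by rw [h1]; linarith

/-- Initial-layer estimate (Proposition 3 of the paper). -/
theorem initial_layer_estimate
    (N : ℕ) (hN : 1 ≤ N) (α : ℝ) (hα : -1 < α)
    (Ω : Set (EucSp N)) (hΩo : IsOpen Ω) (hΩconn : IsConnected Ω)
    (hΩb : Bornology.IsBounded Ω) (hcone : UnifExtCone Ω)
    (T : ℝ) (hT : 0 < T)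
    (F : EucSp N → EucSp N → MatN N → ℝ) (a A : ℝ)
    (hFc : Fcont Ω F) (hF1 : H1 Ω F α) (hF2 : H2 Ω F α a A) (hF3 : H3 Ω F)
    (h : EucSp N → ℝ → EucSp N) (hh : HContBdd Ω T h) (hh5 : H5 Ω T h α)
    (γ c₁ c₂ : ℝ) (hbar : IsBarrierFamily Ω T F h α γ c₁ c₂)
    (ψ : EucSp N → ℝ → ℝ) (cψ Lψ : ℝ) (hcψ : 0 < cψ) (hLψ : 0 < Lψ)
    (hψ : PsiHolderLip Ω T γ cψ Lψ ψ)
    (f : EucSp N → ℝ → ℝ)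
    (hfc : ContinuousOn (fun p : EucSp N × ℝ => f p.1 p.2)
      (closure Ω ×ˢ Set.Icc 0 T))
    (Mf : ℝ) (hfb : ∀ x ∈ Ω, ∀ t ∈ Set.Ioo (0 : ℝ) T, |f x t| ≤ Mf)
    (u : EucSp N → ℝ → ℝ) (hu : IsSolution Ω T F h α f ψ u)
    (q : ℝ) (hq : q = max (2 : ℝ) ((α + 2) / (α + 1)) / γ) :
    ∃ C₂ : ℝ, ∀ x ∈ Ω, ∀ t ∈ Set.Ioo (0 : ℝ) T,
      |u x t - ψ x 0| ≤ C₂ * t ^ (1 / (q * (α + 1) - α)) := by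
  obtain ⟨huc, hsub, hsup, hbdry⟩ := hu
  obtain ⟨⟨hγ0, hγ1⟩, -⟩ := hbar
  obtain ⟨-, H₀, hH₀⟩ := hh
  obtain ⟨x₀, hx₀⟩ := hΩconn.nonempty
  obtain ⟨D₀, hD₀⟩ := Metric.isBounded_iff.mp hΩb
  have hα1 : 0 < α + 1 := by linarith
  set k := max (2 : ℝ) ((α + 2) / (α + 1)) with hk
  have hk2 : 2 ≤ k := le_max_left _ _
  have hkα : α + 2 ≤ k * (α + 1) := (div_le_iff₀ hα1).mp (le_max_right _ _)
  have hkq : γ * q = k := by rw [hq]; field_simp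
  have hkleq : k ≤ q := by
    rw [hq, le_div_iff₀ hγ0]
    nlinarith
  have hq1 : 1 ≤ q := by linarith
  have hE : 1 ≤ q * (α + 1) - α := by nlinarith
  have hM : 0 ≤ Mf := (abs_nonneg _).trans (hfb x₀ hx₀ (T / 2) ⟨by linarith, by linarith⟩)
  have hA : 0 ≤ A := hF2.1.le.trans hF2.2.1
  have hH : ∀ x ∈ Ω, ∀ t ∈ Ioo 0 T, ‖h x t‖ ≤ max H₀ 0 := fun x hx t ht =>
    (hH₀ x hx t ht).trans (le_max_left _ _)
  have hD : ∀ x ∈ Ω, ∀ y ∈ Ω, ‖x - y‖ ≤ max D₀ 1 := fun x hx y hy => by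
    rw [← dist_eq_norm]
    exact (hD₀ hx hy).trans (le_max_left _ _)
  obtain ⟨c, hc0, hc⟩ := exists_radial_operator_bound (α := α) (k := k) (A := A)
    (D := max D₀ 1) (H := max H₀ 0) (n := N) (by linarith) hkα hA
    (lt_max_of_lt_right one_pos) (le_max_right _ _) (Nat.cast_nonneg N)
  have hrad := hsub.radialTimeBound hΩo (by linarith) hF1 hF2 hH hD hc hfb huc
  have hrad' := hsup.radialTimeBound_neg hΩo (by linarith) hF1 hF2 hH hD hc hfb huc
  have hdeg := hsub.degenerateTimeBound hΩo hfb huc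
  have hdeg' := hsup.degenerateTimeBound_neg hΩo hfb huc
  have hψ' : PsiHolderLip Ω T γ cψ Lψ (fun x t => -ψ x t) :=
    ⟨fun x hx y hy t ht => by rw [neg_sub_neg, abs_sub_comm]; exact hψ.1 x hx y hy t ht,
      fun x hx t ht s hs => by rw [neg_sub_neg, abs_sub_comm]; exact hψ.2 x hx t ht s hs⟩
  have hbdry' : BoundaryEq Ω T (fun x t => -u x t) (fun x t => -ψ x t) :=
    ⟨fun x hx t ht => congrArg Neg.neg (hbdry.1 x hx t ht),
      fun x hx => congrArg Neg.neg (hbdry.2 x hx)⟩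
  refine ⟨1 + c * (cψ ^ q) ^ (α + 1) + (Mf + 1 + Lψ) * T ^ (1 - 1 / (q * (α + 1) - α)),
    fun x hx t ht => ?_⟩
  have hε : 0 < t ^ (1 / (q * (α + 1) - α)) := Real.rpow_pos_of_pos ht.1 _
  have hbal := initial_layer_balance (c := c) (M := Mf + 1 + Lψ)
    (Real.rpow_pos_of_pos hcψ q) ht.1 ht.2.le (by linarith) hE
  have hup := le_initial_add hΩo hΩb hk2 hc0 hM hcψ hLψ.le hq1 hkq huc hrad hdeg hψ hbdry
    hx ht hε
  have hlow := le_initial_add hΩo hΩb hk2 hc0 hM hcψ hLψ.le hq1 hkq huc.neg hrad' hdeg' hψ'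
    hbdry' hx ht hε
  rw [abs_le]
  constructor <;> linarith
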